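/- arXiv:2508.18176 — 2 statements merged into one kernel-verified Lean document; each statement's English description precedes it below -/
import Mathlib

section
/- Let (W,S) be a Coxeter system, s ∈ S, and assume W satisfies the nested condition relative to s. Let N_s := {g ∈ W : ℓ(sg) > ℓ(g) and ℓ(gs) > ℓ(g)}, T_s := {t ∈ S : m_{st} = 2}, and W_{T_s} the subgroup generated by T_s. Then for every g ∈ W: g·H_s^+ = H_s^+ iff g ∈ W_{T_s}; g·H_s^+ = H_s^- iff g ∈ W_{T_s}·s; g·H_s^+ ⊊ H_s^+ iff g ∈ (N_s \ W_{T_s})·s; g·H_s^+ ⊊ H_s^- iff g ∈ s·(N_s \ W_{T_s})·s; g·H_s^- ⊊ H_s^+ iff g ∈ N_s \ W_{T_s}; and g·H_s^- ⊊ H_s^- iff g ∈ s·(N_s \ W_{T_s}). -/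
open Pointwise
open scoped Classical

variable {B : Type*} {W : Type*} [Group W] {M : CoxeterMatrix B}

/-- The positive root `H_s^+` associated to the generator indexed by `i`:
elements `g` with `l(sg) > l(g)`. -/
def Hp (cs : CoxeterSystem M W) (i : B) : Set W :=
  {g : W | cs.length g < cs.length (cs.simple i * g)}

/-- The negative root `H_s^-`: elements `g` with `l(sg) < l(g)`. -/
def Hm (cs : CoxeterSystem M W) (i : B) : Set W :=
  {g : W | cs.length (cs.simple i * g) < cs.length g}

/-- `g` satisfies one of the six cases of the nested condition relative to `s`. -/
def NestedAt (cs : CoxeterSystem M W) (i : B) (g : W) : Prop :=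
  g • Hp cs i = Hp cs i ∨ g • Hp cs i = Hm cs i ∨
  g • Hp cs i ⊂ Hp cs i ∨ g • Hp cs i ⊂ Hm cs i ∨
  g • Hm cs i ⊂ Hp cs i ∨ g • Hm cs i ⊂ Hm cs i

/-- `W` satisfies the nested condition relative to the generator indexed by `i`. -/
def Nested (cs : CoxeterSystem M W) (i : B) : Prop := ∀ g : W, NestedAt cs i g

/-- The stabilizer `Stab_{H_s^+}` of the positive root. -/
def StabHp (cs : CoxeterSystem M W) (i : B) : Set W :=
  {g : W | g • Hp cs i = Hp cs i}

/-- The multiplier `m_W^s`. -/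
noncomputable def mWs (cs : CoxeterSystem M W) (i : B) (g : W) : ℤ :=
  if g ∈ Hp cs i then 1 else -1

/-- The set `N_s` of elements without reduced expressions starting or ending with `s`. -/
def Nset (cs : CoxeterSystem M W) (i : B) : Set W :=
  {w : W | cs.length w < cs.length (cs.simple i * w) ∧
    cs.length w < cs.length (w * cs.simple i)}

/-- The parabolic subgroup `W_{T_s}`, `T_s = {t : m_{st} = 2}`. -/
def Tsub (cs : CoxeterSystem M W) (i : B) : Subgroup W :=
  Subgroup.closure (cs.simple '' {j : B | M i j = 2})

/-! ### The geometric representation -/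

/-- The linear form `v ↦ 2 ⟨eᵢ, v⟩` of the geometric representation. -/
noncomputable def rootForm (M : CoxeterMatrix B) (i : B) : (B →₀ ℝ) →ₗ[ℝ] ℝ :=
  Finsupp.linearCombination ℝ fun j => -2 * Real.cos (Real.pi / M i j)

lemma rootForm_single (M : CoxeterMatrix B) (i j : B) :
    rootForm M i (Finsupp.single j 1) = -2 * Real.cos (Real.pi / M i j) := by
  simp [rootForm]

lemma rootForm_single_self (M : CoxeterMatrix B) (i : B) :
    rootForm M i (Finsupp.single i 1) = 2 := by
  simp [rootForm_single]

/-- The reflection of the geometric representation attached to the index `i`. -/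
noncomputable def geomReflection (M : CoxeterMatrix B) (i : B) :
    (B →₀ ℝ) ≃ₗ[ℝ] (B →₀ ℝ) :=
  Module.reflection (rootForm_single_self M i)

lemma geomReflection_apply (M : CoxeterMatrix B) (i : B) (v : B →₀ ℝ) :
    geomReflection M i v = v - rootForm M i v • Finsupp.single i 1 :=
  Module.reflection_apply ..

lemma isLiftable_geomReflection (M : CoxeterMatrix B) : M.IsLiftable (geomReflection M) := by
  intro i j
  rcases eq_or_ne i j with rfl | hij
  · ext1 v
    simpa [geomReflection] using Module.involutive_reflection (rootForm_single_self M i) v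
  have h1 : M i j ≠ 1 := M.off_diagonal i j hij
  have hji : M j i = M i j := M.symmetric j i
  obtain h0 | h2 | h3 : M i j = 0 ∨ M i j = 2 ∨ 3 ≤ M i j := by lia
  · rw [h0, pow_zero]
  · have hi : rootForm M i (Finsupp.single j 1) = 0 := by simp [rootForm_single, h2]
    have hj : rootForm M j (Finsupp.single i 1) = 0 := by simp [rootForm_single, hji, h2]
    have hi' := rootForm_single_self M i
    have hj' := rootForm_single_self M j
    rw [h2, pow_two]
    ext1 v
    simp only [LinearEquiv.mul_apply, geomReflection_apply, map_sub, map_smul, hi, hj, hi', hj',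
      LinearEquiv.coe_one, id_eq]
    module
  · ext1 v
    set m := M i j with hm
    have hm0 : (m : ℝ) ≠ 0 := by positivity
    have ht : (2 * Real.cos (2 * Real.pi / m) : ℝ) =
        rootForm M i (Finsupp.single j 1) * rootForm M j (Finsupp.single i 1) - 2 := by
      rw [rootForm_single, rootForm_single, hji, ← hm, mul_div_assoc, Real.cos_two_mul]
      ring
    have hsin : Real.sin (2 * Real.pi / m) ≠ 0 := by
      refine (Real.sin_pos_of_pos_of_lt_pi (by positivity) ?_).ne'
      have : (3 : ℝ) ≤ m := by exact_mod_cast h3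
      rw [div_lt_iff₀ (by positivity)]
      nlinarith [Real.pi_pos]
    have hS (n : ℤ) := Polynomial.Chebyshev.S_two_mul_real_cos (2 * Real.pi / m) n
    have key := Module.reflection_mul_reflection_pow_apply (rootForm_single_self M i)
      (rootForm_single_self M j) m v _ ht
    rw [LinearEquiv.coe_one, id_eq]
    refine key.trans ?_
    obtain ⟨k, hk | hk⟩ := Nat.even_or_odd' m
    · have e1 : ((m : ℤ) - 2) / 2 = k - 1 := by lia
      have e2 : ((m : ℤ) - 1) / 2 = k - 1 := by lia
      have hz : (Polynomial.Chebyshev.S ℝ (k - 1)).eval (2 * Real.cos (2 * Real.pi / m)) = 0 := by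
        refine (mul_eq_zero.mp ((hS (k - 1)).trans ?_)).resolve_right hsin
        have : (((k - 1 : ℤ) : ℝ) + 1) * (2 * Real.pi / m) = Real.pi := by
          have : (m : ℝ) = 2 * k := by exact_mod_cast hk
          rw [this] at hm0 ⊢
          push_cast
          rw [sub_add_cancel, mul_div_assoc', mul_left_comm, ← mul_assoc, mul_div_cancel_left₀ _ hm0]
        rw [this, Real.sin_pi]
      rw [e1, e2, hz]
      simp
    · have e1 : ((m : ℤ) - 2) / 2 = k - 1 := by lia
      have e2 : ((m : ℤ) - 1) / 2 = k := by lia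
      have e3 : ((m : ℤ) - 3) / 2 = k - 1 := by lia
      have e4 : (m : ℤ) / 2 = k := by lia
      have hz : (Polynomial.Chebyshev.S ℝ k).eval (2 * Real.cos (2 * Real.pi / m)) +
          (Polynomial.Chebyshev.S ℝ (k - 1)).eval (2 * Real.cos (2 * Real.pi / m)) = 0 := by
        refine (mul_eq_zero.mp (?_ : _ * Real.sin (2 * Real.pi / m) = 0)).resolve_right hsin
        rw [add_mul, hS, hS]
        have : (((k : ℤ) : ℝ) + 1) * (2 * Real.pi / m) =
            2 * Real.pi - (((k - 1 : ℤ) : ℝ) + 1) * (2 * Real.pi / m) := by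
          have : (m : ℝ) = 2 * k + 1 := by exact_mod_cast hk
          rw [this] at hm0 ⊢
          push_cast
          field_simp
          ring
        rw [this, Real.sin_two_pi_sub]
        ring
      rw [e1, e2, e3, e4, hz]
      simp

/-- The geometric representation of a Coxeter group. -/
noncomputable def geomRep (cs : CoxeterSystem M W) : W →* ((B →₀ ℝ) ≃ₗ[ℝ] (B →₀ ℝ)) :=
  cs.lift ⟨geomReflection M, isLiftable_geomReflection M⟩

lemma geomRep_simple (cs : CoxeterSystem M W) (i : B) :
    geomRep cs (cs.simple i) = geomReflection M i :=
  cs.lift_apply_simple ..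

lemma simple_injective (cs : CoxeterSystem M W) : Function.Injective cs.simple := by
  intro i j hij
  by_contra hne
  have h : geomReflection M i (Finsupp.single i 1) = geomReflection M j (Finsupp.single i 1) := by
    rw [← geomRep_simple cs, hij, geomRep_simple]
  have := DFunLike.congr_fun h i
  norm_num [geomReflection_apply, rootForm_single_self, hne] at this

lemma matrix_eq_two_of_commute (cs : CoxeterSystem M W) {i j : B} (hij : i ≠ j)
    (hc : cs.simple i * cs.simple j = cs.simple j * cs.simple i) : M i j = 2 := by
  have h := congrArg (geomRep cs) hc
  rw [map_mul, map_mul, geomRep_simple, geomRep_simple] at h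
  have h := DFunLike.congr_fun (LinearEquiv.congr_fun h (Finsupp.single j 1)) i
  simp only [LinearEquiv.mul_apply, geomReflection_apply, map_sub, map_smul, rootForm_single_self]
    at h
  have hcos : Real.cos (Real.pi / M i j) = 0 := by
    simp [rootForm_single, hij] at h
    linarith
  have h1 : M i j ≠ 1 := M.off_diagonal i j hij
  by_contra h2
  obtain h0 | h3 : M i j = 0 ∨ 3 ≤ M i j := by lia
  · simp [h0] at hcos
  · have h3' : (3 : ℝ) ≤ M i j := by exact_mod_cast h3
    refine (Real.cos_pos_of_mem_Ioo ⟨?_, ?_⟩).ne' hcos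
    · have : 0 < Real.pi / M i j := by positivity
      linarith [Real.pi_pos]
    · rw [div_lt_iff₀ (by positivity)]
      nlinarith [Real.pi_pos]

lemma commute_of_matrix_eq_two (cs : CoxeterSystem M W) {i j : B} (h : M i j = 2) :
    Commute (cs.simple i) (cs.simple j) := by
  have hpow := cs.simple_mul_simple_pow i j
  rw [h, pow_two, mul_eq_one_iff_eq_inv, mul_inv_rev, cs.inv_simple, cs.inv_simple] at hpow
  exact hpow

/-! ### The signed action on reflections -/

/-- The action of a simple reflection on signed elements of `W`: conjugation, with a change of
sign at the simple reflection itself. -/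
noncomputable def signedConj (cs : CoxeterSystem M W) (i : B) : Function.End (W × ZMod 2) :=
  fun p => (cs.simple i * p.1 * cs.simple i, p.2 + if p.1 = cs.simple i then 1 else 0)

lemma functionEnd_mul_apply {α : Type*} (f g : Function.End α) (x : α) : (f * g) x = f (g x) :=
  rfl

lemma pow_signedConj_mul_apply (cs : CoxeterSystem M W) (i j : B) (n : ℕ) (t : W) (e : ZMod 2) :
    ((signedConj cs i * signedConj cs j) ^ n) (t, e) =
      ((cs.simple i * cs.simple j) ^ n * t * ((cs.simple i * cs.simple j) ^ n)⁻¹,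
        e + ∑ k ∈ Finset.range (2 * n),
          if t = cs.simple j * (cs.simple i * cs.simple j) ^ k then 1 else 0) := by
  induction n with
  | zero => simp [Function.End.one_def]
  | succ n ih =>
    set a := cs.simple i with ha
    set b := cs.simple j with hb
    have ha' : a⁻¹ = a := cs.inv_simple i
    have hb' : b⁻¹ = b := cs.inv_simple j
    have hconj : ((a * b) ^ n)⁻¹ * b = b * (a * b) ^ n := by
      have : SemiconjBy b (a * b) (a * b)⁻¹ := by
        rw [SemiconjBy, mul_inv_rev, ha', hb', mul_assoc b a b]
      simpa only [inv_pow] using (this.pow_right n).eq.symm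
    have h1 : (a * b) ^ n * t * ((a * b) ^ n)⁻¹ = b ↔ t = b * (a * b) ^ (2 * n) := by
      rw [mul_inv_eq_iff_eq_mul, ← eq_inv_mul_iff_mul_eq, ← mul_assoc, hconj, two_mul, pow_add,
        mul_assoc]
    have h2 : b * ((a * b) ^ n * t * ((a * b) ^ n)⁻¹) * b = a ↔
        t = b * (a * b) ^ (2 * n + 1) := by
      have e1 : ∀ z : W, b * z * b = a ↔ z = b * (a * b) := by
        intro z
        rw [← eq_mul_inv_iff_mul_eq, ← eq_inv_mul_iff_mul_eq, hb']
      rw [e1, mul_inv_eq_iff_eq_mul, ← eq_inv_mul_iff_mul_eq, ← mul_assoc, ← mul_assoc, hconj,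
        mul_assoc, mul_assoc, ← pow_succ', ← pow_add]
      rw [show n + (n + 1) = 2 * n + 1 by ring]
    rw [pow_succ', functionEnd_mul_apply, ih, functionEnd_mul_apply, mul_add, mul_one,
      Finset.sum_range_succ, Finset.sum_range_succ]
    simp only [signedConj, ← ha, ← hb, h1, h2, Prod.mk.injEq]
    refine ⟨?_, by ring⟩
    rw [pow_succ', mul_inv_rev, mul_inv_rev, ha', hb']
    simp only [mul_assoc]

lemma isLiftable_signedConj (cs : CoxeterSystem M W) : M.IsLiftable (signedConj cs) := by
  intro i j
  funext ⟨t, e⟩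
  have hr := cs.simple_mul_simple_pow i j
  rw [pow_signedConj_mul_apply, hr, two_mul, Finset.sum_range_add]
  simp only [pow_add, hr, one_mul, inv_one, mul_one, CharTwo.add_self_eq_zero, add_zero,
    Function.End.one_def, id_eq]

/-- The homomorphism describing the signed conjugation action of `W`. -/
noncomputable def signedAction (cs : CoxeterSystem M W) : W →* Function.End (W × ZMod 2) :=
  cs.lift ⟨signedConj cs, isLiftable_signedConj cs⟩

/-- The parity of the number of times `t` occurs in the right inversion sequence of a word
for `w`. -/
noncomputable def inversionParity (cs : CoxeterSystem M W) (w t : W) : ZMod 2 :=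
  (signedAction cs w (t, 0)).2

lemma signedAction_simple (cs : CoxeterSystem M W) (i : B) :
    signedAction cs (cs.simple i) = signedConj cs i :=
  cs.lift_apply_simple ..

lemma signedAction_apply (cs : CoxeterSystem M W) (w t : W) (e : ZMod 2) :
    signedAction cs w (t, e) = (w * t * w⁻¹, e + inversionParity cs w t) := by
  unfold inversionParity
  induction w using cs.simple_induction_left generalizing e with
  | one => simp [Function.End.one_def]
  | mul_simple_left w i ih =>
    rw [map_mul, functionEnd_mul_apply, functionEnd_mul_apply, ih e, ih 0,
      signedAction_simple]
    simp [signedConj, mul_assoc, add_assoc]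

lemma inversionParity_mul (cs : CoxeterSystem M W) (u v t : W) :
    inversionParity cs (u * v) t =
      inversionParity cs v t + inversionParity cs u (v * t * v⁻¹) := by
  rw [inversionParity, map_mul, functionEnd_mul_apply, signedAction_apply,
    signedAction_apply, zero_add]

lemma inversionParity_one (cs : CoxeterSystem M W) (t : W) : inversionParity cs 1 t = 0 := by
  simp [inversionParity, Function.End.one_def]

lemma inversionParity_simple (cs : CoxeterSystem M W) (i : B) (t : W) :
    inversionParity cs (cs.simple i) t = if t = cs.simple i then 1 else 0 := by
  simp [inversionParity, signedAction_simple, signedConj]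

lemma mem_rightInvSeq_of_inversionParity_ne_zero (cs : CoxeterSystem M W) {ω : List B} {t : W}
    (h : inversionParity cs (cs.wordProd ω) t ≠ 0) : t ∈ cs.rightInvSeq ω := by
  induction ω with
  | nil => simp [inversionParity_one] at h
  | cons i ω ih =>
    rw [cs.wordProd_cons, inversionParity_mul, inversionParity_simple] at h
    rw [CoxeterSystem.rightInvSeq, List.mem_cons]
    by_cases h' : cs.wordProd ω * t * (cs.wordProd ω)⁻¹ = cs.simple i
    · left
      rw [← h']
      group
    · right
      rw [if_neg h', add_zero] at h
      exact ih h

lemma length_mul_lt_of_inversionParity_ne_zero (cs : CoxeterSystem M W) {w t : W}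
    (h : inversionParity cs w t ≠ 0) : cs.length (w * t) < cs.length w := by
  obtain ⟨ω, hω, rfl⟩ := cs.exists_isReduced w
  exact (cs.isRightInversion_of_mem_rightInvSeq hω
    (mem_rightInvSeq_of_inversionParity_ne_zero cs h)).2

lemma inversionParity_eq_zero_iff (cs : CoxeterSystem M W) (w : W) (i : B) :
    inversionParity cs w (cs.simple i) = 0 ↔ cs.length w < cs.length (w * cs.simple i) := by
  refine ⟨fun h => ?_, fun h => ?_⟩
  · have h' : inversionParity cs (w * cs.simple i) (cs.simple i) ≠ 0 := by
      simp [inversionParity_mul, inversionParity_simple, h]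
    simpa using length_mul_lt_of_inversionParity_ne_zero cs h'
  · by_contra h'
    exact (length_mul_lt_of_inversionParity_ne_zero cs h').not_gt h

/-! ### Roots and walls -/

lemma mem_Hp_iff (cs : CoxeterSystem M W) (i : B) (x : W) :
    x ∈ Hp cs i ↔ inversionParity cs x⁻¹ (cs.simple i) = 0 := by
  rw [inversionParity_eq_zero_iff, ← cs.length_inv (x⁻¹ * _), cs.length_inv x]
  simp [Hp]

lemma mem_Hm_iff_notMem_Hp (cs : CoxeterSystem M W) (i : B) (x : W) :
    x ∈ Hm cs i ↔ x ∉ Hp cs i := by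
  have := cs.length_simple_mul_ne x i
  simp only [Hm, Hp, Set.mem_ofPred_eq]
  lia

lemma mem_Hp_iff_notMem_Hm (cs : CoxeterSystem M W) (i : B) (x : W) :
    x ∈ Hp cs i ↔ x ∉ Hm cs i := by
  rw [mem_Hm_iff_notMem_Hp, not_not]

lemma inv_mem_Hp_iff (cs : CoxeterSystem M W) (i : B) (x : W) :
    x⁻¹ ∈ Hp cs i ↔ cs.length x < cs.length (x * cs.simple i) := by
  rw [mem_Hp_iff, inv_inv, inversionParity_eq_zero_iff]

lemma mem_Nset_iff (cs : CoxeterSystem M W) (i : B) (x : W) :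
    x ∈ Nset cs i ↔ x ∈ Hp cs i ∧ x⁻¹ ∈ Hp cs i := by
  rw [inv_mem_Hp_iff]
  rfl

lemma one_mem_Hp (cs : CoxeterSystem M W) (i : B) : 1 ∈ Hp cs i := by
  simp [mem_Hp_iff, inversionParity_one]

lemma simple_mul_mem_Hm_iff (cs : CoxeterSystem M W) (i : B) (x : W) :
    cs.simple i * x ∈ Hm cs i ↔ x ∈ Hp cs i := by
  simp [Hm, Hp]

lemma simple_mul_mem_Hp_iff (cs : CoxeterSystem M W) (i : B) (x : W) :
    cs.simple i * x ∈ Hp cs i ↔ x ∈ Hm cs i := by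
  simp [Hm, Hp]

lemma simple_mem_Hm (cs : CoxeterSystem M W) (i : B) : cs.simple i ∈ Hm cs i := by
  simpa using (simple_mul_mem_Hm_iff cs i 1).mpr (one_mem_Hp cs i)

lemma simple_mem_Hp_of_ne (cs : CoxeterSystem M W) {i j : B}
    (h : cs.simple i ≠ cs.simple j) : cs.simple j ∈ Hp cs i := by
  simp [mem_Hp_iff, inversionParity_simple, h]

lemma simple_smul_Hp (cs : CoxeterSystem M W) (i : B) : cs.simple i • Hp cs i = Hm cs i := by
  ext x
  rw [Set.mem_smul_set_iff_inv_smul_mem, cs.inv_simple, smul_eq_mul, simple_mul_mem_Hp_iff]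

lemma simple_smul_Hm (cs : CoxeterSystem M W) (i : B) : cs.simple i • Hm cs i = Hp cs i := by
  ext x
  rw [Set.mem_smul_set_iff_inv_smul_mem, cs.inv_simple, smul_eq_mul, simple_mul_mem_Hm_iff]

/-- Adjacent chambers separated by the wall of `s` are exchanged by `s`. -/
lemma mul_simple_eq_of_mem_Hp_of_mem_Hm (cs : CoxeterSystem M W) {i j : B} {x : W}
    (h : x ∈ Hp cs i) (h' : x * cs.simple j ∈ Hm cs i) :
    x * cs.simple j = cs.simple i * x := by
  rw [mem_Hm_iff_notMem_Hp, mem_Hp_iff, mul_inv_rev, cs.inv_simple, inversionParity_mul,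
    (mem_Hp_iff cs i x).mp h, zero_add, inversionParity_simple, inv_inv] at h'
  have h'' : x⁻¹ * cs.simple i * x = cs.simple j := by
    by_contra hne
    simp [hne] at h'
  rw [← h'']
  group

lemma mul_simple_eq_of_mem_Hm_of_mem_Hp (cs : CoxeterSystem M W) {i j : B} {x : W}
    (h : x ∈ Hm cs i) (h' : x * cs.simple j ∈ Hp cs i) :
    x * cs.simple j = cs.simple i * x := by
  have := mul_simple_eq_of_mem_Hp_of_mem_Hm cs (j := j) h' (by simpa using h)
  rw [cs.simple_mul_simple_cancel_right] at this
  conv_rhs => rw [this, cs.simple_mul_simple_cancel_left]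

lemma mul_mem_Hp_iff_of_commute (cs : CoxeterSystem M W) {i : B} {g : W}
    (hc : Commute g (cs.simple i)) (hg : g ∈ Hp cs i) (x : W) :
    g * x ∈ Hp cs i ↔ x ∈ Hp cs i := by
  have : g⁻¹ * cs.simple i * g = cs.simple i := by rw [mul_assoc, ← hc.eq, inv_mul_cancel_left]
  rw [mem_Hp_iff, mul_inv_rev, inversionParity_mul, (mem_Hp_iff cs i g).mp hg, inv_inv, this,
    zero_add, mem_Hp_iff]

lemma mul_mem_Hp_iff_of_commute_of_mem_Hm (cs : CoxeterSystem M W) {i : B} {g : W}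
    (hc : Commute g (cs.simple i)) (hg : g ∈ Hm cs i) (x : W) :
    g * x ∈ Hp cs i ↔ x ∈ Hm cs i := by
  have := mul_mem_Hp_iff_of_commute cs (i := i) (g := cs.simple i * g)
    ((Commute.refl _).mul_left hc) ((simple_mul_mem_Hp_iff ..).mpr hg) x
  rw [mul_assoc, simple_mul_mem_Hp_iff, mem_Hm_iff_notMem_Hp] at this
  rw [mem_Hm_iff_notMem_Hp, ← this, not_not]

lemma smul_Hp_eq_Hp_iff (cs : CoxeterSystem M W) (i : B) (g : W) :
    g • Hp cs i = Hp cs i ↔ Commute g (cs.simple i) ∧ g ∈ Hp cs i := by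
  constructor
  · intro h
    have hmem (x : W) : g * x ∈ Hp cs i ↔ x ∈ Hp cs i := by
      conv_lhs => rw [← h]
      exact Set.smul_mem_smul_set_iff
    have hg : g ∈ Hp cs i := by simpa using (hmem 1).mpr (one_mem_Hp cs i)
    refine ⟨mul_simple_eq_of_mem_Hp_of_mem_Hm cs hg ?_, hg⟩
    rw [mem_Hm_iff_notMem_Hp, hmem, ← mem_Hm_iff_notMem_Hp]
    exact simple_mem_Hm cs i
  · rintro ⟨hc, hg⟩
    ext x
    rw [Set.mem_smul_set_iff_inv_smul_mem, ← mul_mem_Hp_iff_of_commute cs hc hg, smul_eq_mul,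
      mul_inv_cancel_left]

/-! ### Consequences of the nested condition -/

lemma NestedAt.cases {cs : CoxeterSystem M W} {i : B} {g : W} (h : NestedAt cs i g) :
    (∀ x ∈ Hp cs i, g * x ∈ Hp cs i) ∨ (∀ x ∈ Hp cs i, g * x ∈ Hm cs i) ∨
      (∀ x ∈ Hm cs i, g * x ∈ Hp cs i) ∨ (∀ x ∈ Hm cs i, g * x ∈ Hm cs i) := by
  simp only [← smul_eq_mul, ← Set.smul_set_subset_iff]
  rcases h with h | h | h | h | h | h
  · exact .inl h.subset
  · exact .inr (.inl h.subset)
  · exact .inl h.subset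
  · exact .inr (.inl h.subset)
  · exact .inr (.inr (.inl h.subset))
  · exact .inr (.inr (.inr h.subset))

lemma simple_mul_mem_Hp_of_not_commute {cs : CoxeterSystem M W} {i j : B} (hnest : Nested cs i)
    (hc : ¬Commute (cs.simple j) (cs.simple i)) {x : W} (hx : x ∈ Hm cs i) :
    cs.simple j * x ∈ Hp cs i := by
  have hne : cs.simple i ≠ cs.simple j := fun h => hc (h ▸ Commute.refl _)
  have hj : cs.simple j ∈ Hp cs i := simple_mem_Hp_of_ne cs hne
  have hji : cs.simple j * cs.simple i ∈ Hp cs i := by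
    by_contra h
    exact hc (mul_simple_eq_of_mem_Hp_of_mem_Hm cs hj ((mem_Hm_iff_notMem_Hp ..).mpr h))
  rcases (hnest (cs.simple j)).cases with h | h | h | h
  · have := h _ hji
    rw [cs.simple_mul_simple_cancel_left, mem_Hp_iff_notMem_Hm] at this
    exact absurd (simple_mem_Hm cs i) this
  · have := h _ (one_mem_Hp cs i)
    rw [mul_one, mem_Hm_iff_notMem_Hp] at this
    exact absurd hj this
  · exact h x hx
  · exact absurd hji ((mem_Hm_iff_notMem_Hp ..).mp (h _ (simple_mem_Hm cs i)))

/-- The alternating product `a * b * a * ⋯` with `n` factors. -/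
def alternatingProd {G : Type*} [Monoid G] (a b : G) : ℕ → G
  | 0 => 1
  | n + 1 => a * alternatingProd b a n

lemma alternatingProd_succ_right {G : Type*} [Monoid G] (a b : G) (n : ℕ) :
    alternatingProd a b (n + 1) = alternatingProd a b n * a ∨
      alternatingProd a b (n + 1) = alternatingProd a b n * b := by
  induction n generalizing a b with
  | zero => simp [alternatingProd]
  | succ n ih =>
    have hs (n : ℕ) : alternatingProd a b (n + 1) = a * alternatingProd b a n := rfl
    rw [hs (n + 1)]
    rcases ih b a with h | h
    · right
      rw [h, ← mul_assoc, hs]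
    · left
      rw [h, ← mul_assoc, hs]

lemma exists_mul_alternatingProd {G : Type*} [Monoid G] {a b : G} (ha : a * a = 1) {d : G}
    (hd : ∃ n, d = alternatingProd a b n ∨ d = alternatingProd b a n) :
    ∃ n, a * d = alternatingProd a b n ∨ a * d = alternatingProd b a n := by
  obtain ⟨_ | n, rfl | rfl⟩ := hd
  · exact ⟨1, .inl rfl⟩
  · exact ⟨1, .inl rfl⟩
  · exact ⟨n, .inr (by rw [alternatingProd, ← mul_assoc, ha, one_mul])⟩
  · exact ⟨n + 2, .inl rfl⟩

/-- The side of `x` of the walls of `i` and `j` agrees with that of an element of the dihedral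
subgroup generated by the two simple reflections. -/
lemma exists_alternatingProd_mem_Hm_iff (cs : CoxeterSystem M W) (i j : B) (x : W) :
    ∃ d, (∃ n, d = alternatingProd (cs.simple i) (cs.simple j) n ∨
        d = alternatingProd (cs.simple j) (cs.simple i) n) ∧
      (x ∈ Hp cs i ↔ d ∈ Hp cs i) ∧ (x ∈ Hp cs j ↔ d ∈ Hp cs j) := by
  set D : Set W := {d | ∃ n, d = alternatingProd (cs.simple i) (cs.simple j) n ∨
    d = alternatingProd (cs.simple j) (cs.simple i) n}
  have hDi {d : W} (hd : d ∈ D) : cs.simple i * d ∈ D :=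
    exists_mul_alternatingProd (cs.simple_mul_simple_self i) hd
  have hDj {d : W} (hd : d ∈ D) : cs.simple j * d ∈ D := by
    obtain ⟨n, hn⟩ := hd
    obtain ⟨m, hm⟩ := exists_mul_alternatingProd (cs.simple_mul_simple_self j) ⟨n, hn.symm⟩
    exact ⟨m, hm.symm⟩
  obtain ⟨d, hd, hmin⟩ := exists_minimalFor_of_wellFoundedLT (· ∈ D)
    (fun d => cs.length (d⁻¹ * x)) ⟨1, 0, .inl rfl⟩
  have key (k : B) (hk : cs.simple k * d ∈ D) : x ∈ Hp cs k ↔ d ∈ Hp cs k := by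
    have hzero : inversionParity cs (x⁻¹ * d) (d⁻¹ * cs.simple k * d) = 0 := by
      by_contra h
      have hlt := length_mul_lt_of_inversionParity_ne_zero cs h
      rw [← cs.length_inv, ← cs.length_inv (x⁻¹ * d)] at hlt
      have e1 : (x⁻¹ * d * (d⁻¹ * cs.simple k * d))⁻¹ = (cs.simple k * d)⁻¹ * x := by group
      have e2 : (x⁻¹ * d)⁻¹ = d⁻¹ * x := by group
      rw [e1, e2] at hlt
      exact absurd (hmin hk hlt.le) (not_le.mpr hlt)
    have e : x⁻¹ = (x⁻¹ * d) * d⁻¹ := by group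
    rw [mem_Hp_iff, mem_Hp_iff, e, inversionParity_mul, inv_inv, hzero, add_zero]
  exact ⟨d, hd, key i (hDi hd), key j (hDj hd)⟩

lemma alternatingProd_mem_Hp {cs : CoxeterSystem M W} {i j : B} (hnest : Nested cs i)
    (hc : ¬Commute (cs.simple j) (cs.simple i)) (n : ℕ) :
    alternatingProd (cs.simple j) (cs.simple i) n ∈ Hp cs i := by
  induction n using Nat.twoStepInduction with
  | zero => exact one_mem_Hp cs i
  | one =>
    rw [alternatingProd, alternatingProd, mul_one]
    exact simple_mem_Hp_of_ne cs fun h => hc (h ▸ Commute.refl _)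
  | more n ih _ =>
    exact simple_mul_mem_Hp_of_not_commute hnest hc ((simple_mul_mem_Hm_iff ..).mpr ih)

lemma alternatingProd_mem_Hp' {cs : CoxeterSystem M W} {i j : B} (hnest : Nested cs i)
    (hc : ¬Commute (cs.simple j) (cs.simple i)) (n : ℕ) :
    alternatingProd (cs.simple i) (cs.simple j) n ∈ Hp cs j := by
  induction n with
  | zero => exact one_mem_Hp cs j
  | succ n ih =>
    by_contra h
    rw [← mem_Hm_iff_notMem_Hp] at h
    have heq : alternatingProd (cs.simple i) (cs.simple j) (n + 1) =
        alternatingProd (cs.simple j) (cs.simple i) (n + 1) := by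
      rcases alternatingProd_succ_right (cs.simple i) (cs.simple j) n with hn | hn <;>
      · rw [hn] at h ⊢
        exact mul_simple_eq_of_mem_Hp_of_mem_Hm cs ih h
    have h1 := alternatingProd_mem_Hp hnest hc (n + 1)
    rw [← heq, alternatingProd, simple_mul_mem_Hp_iff, mem_Hm_iff_notMem_Hp] at h1
    exact h1 (alternatingProd_mem_Hp hnest hc n)

lemma notMem_Hm_of_mem_Hm {cs : CoxeterSystem M W} {i j : B} (hnest : Nested cs i)
    (hc : ¬Commute (cs.simple j) (cs.simple i)) {x : W} (hx : x ∈ Hm cs i) : x ∉ Hm cs j := by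
  obtain ⟨d, ⟨n, rfl | rfl⟩, hi, hj⟩ := exists_alternatingProd_mem_Hm_iff cs i j x
  · rw [← mem_Hp_iff_notMem_Hm, hj]
    exact alternatingProd_mem_Hp' hnest hc n
  · exact absurd (hi.mpr (alternatingProd_mem_Hp hnest hc n)) ((mem_Hm_iff_notMem_Hp ..).mp hx)

lemma commute_and_mem_Hp_of_mem_Tsub {cs : CoxeterSystem M W} {i : B} {g : W}
    (hg : g ∈ Tsub cs i) : Commute g (cs.simple i) ∧ g ∈ Hp cs i := by
  have hle : Tsub cs i ≤ MulAction.stabilizer W (Hp cs i) := by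
    rw [Tsub, Subgroup.closure_le]
    rintro _ ⟨j, hj, rfl⟩
    refine (smul_Hp_eq_Hp_iff cs i _).mpr
      ⟨(commute_of_matrix_eq_two cs hj).symm, simple_mem_Hp_of_ne cs fun h => ?_⟩
    have hj : M i j = 2 := hj
    rw [simple_injective cs h, M.diagonal] at hj
    exact absurd hj (by decide)
  exact (smul_Hp_eq_Hp_iff cs i g).mp (hle hg)

lemma mem_Tsub_of_commute {cs : CoxeterSystem M W} {i : B} (hnest : Nested cs i) {g : W}
    (hc : Commute g (cs.simple i)) (hg : g ∈ Hp cs i) : g ∈ Tsub cs i := by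
  induction hn : cs.length g using Nat.strong_induction_on generalizing g with
  | _ n ih =>
  rcases eq_or_ne g 1 with rfl | hne
  · exact one_mem _
  obtain ⟨j, hj⟩ := cs.exists_leftDescent_of_ne_one hne
  have hj : g ∈ Hm cs j := hj
  have hij : i ≠ j := by
    rintro rfl
    exact (mem_Hp_iff_notMem_Hm ..).mp hg hj
  have hsij : cs.simple i ≠ cs.simple j := fun h => hij (simple_injective cs h)
  by_cases hcj : Commute (cs.simple j) (cs.simple i)
  · have hjT : cs.simple j ∈ Tsub cs i :=
      Subgroup.subset_closure ⟨j, matrix_eq_two_of_commute cs hij hcj.symm, rfl⟩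
    rw [← Subgroup.mul_mem_cancel_left _ hjT]
    refine ih _ (hn ▸ hj) (hcj.mul_left hc) ?_ rfl
    exact (mul_mem_Hp_iff_of_commute cs hcj (simple_mem_Hp_of_ne cs hsij) g).mpr hg
  · have h1 : g * cs.simple i ∈ Hm cs i := by
      rw [hc.eq, simple_mul_mem_Hm_iff]
      exact hg
    have h2 := notMem_Hm_of_mem_Hm hnest hcj h1
    rw [← mem_Hp_iff_notMem_Hm] at h2
    have h3 := mul_simple_eq_of_mem_Hm_of_mem_Hp cs hj h2
    exact absurd (mul_right_cancel (hc.eq.symm.trans h3)) hsij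

lemma smul_Hp_eq_Hp_iff_mem_Tsub {cs : CoxeterSystem M W} {i : B} (hnest : Nested cs i) (g : W) :
    g • Hp cs i = Hp cs i ↔ g ∈ Tsub cs i := by
  rw [smul_Hp_eq_Hp_iff]
  exact ⟨fun h => mem_Tsub_of_commute hnest h.1 h.2, commute_and_mem_Hp_of_mem_Tsub⟩

lemma smul_Hm_ssubset_Hp_iff {cs : CoxeterSystem M W} {i : B} (hnest : Nested cs i) (g : W) :
    g • Hm cs i ⊂ Hp cs i ↔ g ∈ Nset cs i \ (Tsub cs i : Set W) := by
  have hs := simple_mem_Hm cs i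
  simp only [Set.mem_sdiff, SetLike.mem_coe, mem_Nset_iff, ssubset_iff_subset_not_subset,
    Set.smul_set_subset_iff, smul_eq_mul]
  constructor
  · rintro ⟨hsub, hnsub⟩
    have hgs : g * cs.simple i ∈ Hp cs i := hsub hs
    have hgs' : g⁻¹ * cs.simple i ∈ Hp cs i := by
      by_contra h
      have := hsub ((mem_Hm_iff_notMem_Hp ..).mpr h)
      rw [mul_inv_cancel_left, mem_Hp_iff_notMem_Hm] at this
      exact this hs
    have hcomm (hc : Commute g (cs.simple i)) : g ∉ Hp cs i := fun hg =>
      (mem_Hm_iff_notMem_Hp ..).mp hs ((mul_mem_Hp_iff_of_commute cs hc hg _).mp hgs)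
    have hg : g ∈ Hp cs i := by
      by_contra h
      rw [← mem_Hm_iff_notMem_Hp] at h
      have hc : Commute g (cs.simple i) := mul_simple_eq_of_mem_Hm_of_mem_Hp cs h hgs
      refine hnsub fun x hx => ?_
      rwa [Set.mem_smul_set_iff_inv_smul_mem, smul_eq_mul,
        ← mul_mem_Hp_iff_of_commute_of_mem_Hm cs hc h, mul_inv_cancel_left]
    refine ⟨⟨hg, ?_⟩, fun hT => hcomm (commute_and_mem_Hp_of_mem_Tsub hT).1 hg⟩
    by_contra h
    rw [← mem_Hm_iff_notMem_Hp] at h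
    have hc : Commute g⁻¹ (cs.simple i) := mul_simple_eq_of_mem_Hm_of_mem_Hp cs h hgs'
    exact hcomm (by simpa using hc.inv_left) hg
  · rintro ⟨⟨hg, hg'⟩, hT⟩
    have hgs : g * cs.simple i ∈ Hp cs i := by
      by_contra h
      exact hT (mem_Tsub_of_commute hnest
        (mul_simple_eq_of_mem_Hp_of_mem_Hm cs hg ((mem_Hm_iff_notMem_Hp ..).mpr h)) hg)
    have hgs' : g⁻¹ * cs.simple i ∈ Hp cs i := by
      by_contra h
      have hc : Commute g⁻¹ (cs.simple i) :=
        mul_simple_eq_of_mem_Hp_of_mem_Hm cs hg' ((mem_Hm_iff_notMem_Hp ..).mpr h)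
      exact hT (mem_Tsub_of_commute hnest (by simpa using hc.inv_left) hg)
    refine ⟨?_, fun h => ?_⟩
    · rcases (hnest g).cases with h | h | h | h
      · have := h _ hgs'
        rw [mul_inv_cancel_left, mem_Hp_iff_notMem_Hm] at this
        exact absurd hs this
      · have := h 1 (one_mem_Hp cs i)
        rw [mul_one, mem_Hm_iff_notMem_Hp] at this
        exact absurd hg this
      · exact fun x hx => h x hx
      · exact absurd hgs ((mem_Hm_iff_notMem_Hp ..).mp (h _ hs))
    · have := h hg
      rw [Set.mem_smul_set_iff_inv_smul_mem, smul_eq_mul, inv_mul_cancel,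
        mem_Hm_iff_notMem_Hp] at this
      exact this (one_mem_Hp cs i)

lemma exists_mem_and_eq_mul_simple (cs : CoxeterSystem M W) (i : B) (g : W) (A : Set W) :
    (∃ a ∈ A, g = a * cs.simple i) ↔ g * cs.simple i ∈ A := by
  constructor
  · rintro ⟨a, ha, rfl⟩
    simpa using ha
  · exact fun h => ⟨_, h, by simp⟩

lemma exists_mem_and_eq_simple_mul (cs : CoxeterSystem M W) (i : B) (g : W) (A : Set W) :
    (∃ a ∈ A, g = cs.simple i * a) ↔ cs.simple i * g ∈ A := by
  constructor
  · rintro ⟨a, ha, rfl⟩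
    simpa using ha
  · exact fun h => ⟨_, h, by simp⟩

lemma simple_mul_smul_ssubset_Hp_iff (cs : CoxeterSystem M W) (i : B) (g : W) (A : Set W) :
    (cs.simple i * g) • A ⊂ Hp cs i ↔ g • A ⊂ Hm cs i := by
  simp only [ssubset_iff_subset_not_subset]
  rw [← simple_smul_Hm, mul_smul, Set.smul_set_subset_smul_set_iff,
    Set.smul_set_subset_smul_set_iff]

/-- Algebraic characterization of the six cases in the nested condition. -/
theorem nested_cases_algebraic (cs : CoxeterSystem M W) (i : B) (hnest : Nested cs i) (g : W) :
    (g • Hp cs i = Hp cs i ↔ g ∈ Tsub cs i) ∧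
    (g • Hp cs i = Hm cs i ↔ ∃ a ∈ Tsub cs i, g = a * cs.simple i) ∧
    (g • Hp cs i ⊂ Hp cs i ↔
      ∃ a ∈ Nset cs i \ (Tsub cs i : Set W), g = a * cs.simple i) ∧
    (g • Hp cs i ⊂ Hm cs i ↔
      ∃ a ∈ Nset cs i \ (Tsub cs i : Set W), g = cs.simple i * a * cs.simple i) ∧
    (g • Hm cs i ⊂ Hp cs i ↔ g ∈ Nset cs i \ (Tsub cs i : Set W)) ∧
    (g • Hm cs i ⊂ Hm cs i ↔
      ∃ a ∈ Nset cs i \ (Tsub cs i : Set W), g = cs.simple i * a) := by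
  have h5 := smul_Hm_ssubset_Hp_iff hnest
  refine ⟨smul_Hp_eq_Hp_iff_mem_Tsub hnest g, ?_, ?_, ?_, h5 g, ?_⟩
  · refine Iff.trans ?_ (exists_mem_and_eq_mul_simple cs i g (Tsub cs i : Set W)).symm
    rw [SetLike.mem_coe, ← smul_Hp_eq_Hp_iff_mem_Tsub hnest, mul_smul, simple_smul_Hp]
    have hcompl : Hm cs i = (Hp cs i)ᶜ := Set.ext (mem_Hm_iff_notMem_Hp cs i)
    rw [hcompl, Set.smul_set_compl, compl_eq_comm, eq_comm]
  · rw [exists_mem_and_eq_mul_simple, ← h5, mul_smul, simple_smul_Hm]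
  · have : ∀ a, g = cs.simple i * a * cs.simple i ↔ g * cs.simple i = cs.simple i * a := fun a =>
      ⟨by rintro rfl; simp, fun h => by rw [← h]; simp⟩
    simp only [this]
    rw [exists_mem_and_eq_simple_mul, ← h5, simple_mul_smul_ssubset_Hp_iff, mul_smul,
      simple_smul_Hm]
  · rw [exists_mem_and_eq_simple_mul, ← h5, simple_mul_smul_ssubset_Hp_iff]
end

section
/- Let (W,S) be a Coxeter system with S finite, s ∈ S, and let W₀ be a torsion-free subgroup of W (no element of W₀ other than the identity has finite order) such that sW₀s = W₀. Then the multiplier m_W^s restricted to W₀ satisfies the Cotlar identity relative to W₀ ∩ Stab_{H_s^+}: for every g ∈ W₀ with g·H_s^+ ≠ H_s^+ and every h ∈ W₀, (m_W^s(g) − m_W^s(h))·(m_W^s(g⁻¹h) − m_W^s(g⁻¹)) = 0. -/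
open Pointwise
open scoped Classical

variable {B : Type*} {W : Type*} [Group W] {M : CoxeterMatrix B}

namespace CoxeterSystem

variable (cs : CoxeterSystem M W)

/-- The involution `(r, ε) ↦ (sᵢ r sᵢ, ε + [r = sᵢ])` of `W × ZMod 2`. -/
noncomputable def signedConj (i : B) : Function.End (W × ZMod 2) :=
  fun p => (cs.simple i * p.1 * cs.simple i, p.2 + if p.1 = cs.simple i then 1 else 0)

theorem signedConj_mul_pow (i j : B) (k : ℕ) (r : W) (ε : ZMod 2) :
    ((cs.signedConj i * cs.signedConj j) ^ k) (r, ε) =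
      ((cs.simple i * cs.simple j) ^ k * r * ((cs.simple i * cs.simple j) ^ k)⁻¹,
        ε + ∑ q ∈ Finset.range (2 * k),
          if r = cs.simple j * (cs.simple i * cs.simple j) ^ q then 1 else 0) := by
  induction k with
  | zero => simp; rfl
  | succ k ih =>
    set a := cs.simple i with ha
    set b := cs.simple j with hb
    have hbb : b * b = 1 := cs.simple_mul_simple_self j
    have ha' : a⁻¹ = a := cs.inv_simple i
    have hb' : b⁻¹ = b := cs.inv_simple j
    have hconj : ∀ n : ℕ, ((a * b) ^ n)⁻¹ * b = b * (a * b) ^ n := by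
      intro n
      have : (b * (a * b) * b⁻¹) ^ n = b * (a * b) ^ n * b⁻¹ := conj_pow
      rw [← inv_pow, mul_inv_rev, ha', hb']
      rw [hb', ← mul_assoc, mul_assoc (b * a), hbb, mul_one] at this
      rw [this, mul_assoc, hbb, mul_one]
    have h₁ : ((a * b) ^ k * r * ((a * b) ^ k)⁻¹ = b) ↔ r = b * (a * b) ^ (2 * k) := by
      rw [mul_inv_eq_iff_eq_mul, ← eq_inv_mul_iff_mul_eq, ← mul_assoc, hconj, mul_assoc,
        ← pow_add, two_mul]
    have h₂ : (b * ((a * b) ^ k * r * ((a * b) ^ k)⁻¹) * b = a) ↔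
        r = b * (a * b) ^ (2 * k + 1) := by
      have e : b * (a * b) ^ (2 * k + 1) = ((a * b) ^ k)⁻¹ * (b * a * b) * (a * b) ^ k := by
        rw [mul_assoc b a b, ← mul_assoc _ b, hconj, mul_assoc, mul_assoc, ← pow_succ',
          ← pow_add]
        congr 2; ring
      rw [e]
      constructor
      · intro h
        have hx : ∀ y, b * y * b = a → b * a * b = y := by
          intro y hy
          rw [← hy, mul_assoc, mul_assoc (b * y), hbb, mul_one, ← mul_assoc, hbb, one_mul]
        rw [hx _ h]
        group
      · rintro rfl
        simp only [mul_assoc, mul_inv_cancel_left, mul_inv_cancel, mul_one, hbb]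
        simp only [← mul_assoc, hbb, one_mul]
    rw [pow_succ']
    change (cs.signedConj i (cs.signedConj j (((cs.signedConj i * cs.signedConj j) ^ k) (r, ε)))) = _
    rw [ih]
    simp only [signedConj, ← ha, ← hb]
    rw [show 2 * (k + 1) = 2 * k + 1 + 1 by ring, Finset.sum_range_succ, Finset.sum_range_succ]
    simp only [h₁, h₂, ← add_assoc]
    refine Prod.ext ?_ rfl
    simp only [pow_succ' (a * b) k, mul_inv_rev, ha', hb', mul_assoc]

theorem isLiftable_signedConj : M.IsLiftable cs.signedConj := by
  intro i j
  funext ⟨r, ε⟩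
  rw [signedConj_mul_pow, two_mul, Finset.sum_range_add]
  simp only [pow_add, cs.simple_mul_simple_pow, one_mul, mul_one, inv_one]
  rw [CharTwo.add_self_eq_zero, add_zero]
  rfl

/-- The action of `W` on `W × ZMod 2` extending `signedConj`. -/
noncomputable def signedConjHom : W →* Function.End (W × ZMod 2) :=
  cs.lift ⟨cs.signedConj, cs.isLiftable_signedConj⟩

theorem signedConjHom_wordProd (ω : List B) (r : W) (ε : ZMod 2) :
    cs.signedConjHom (cs.wordProd ω) (r, ε) =
      (cs.wordProd ω * r * (cs.wordProd ω)⁻¹, ε + ((cs.rightInvSeq ω).count r : ZMod 2)) := by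
  induction ω with
  | nil => simp; rfl
  | cons i ω ih =>
    rw [wordProd_cons, map_mul]
    change cs.signedConjHom (cs.simple i) (cs.signedConjHom (cs.wordProd ω) (r, ε)) = _
    rw [ih, signedConjHom, lift_apply_simple]
    have h : (cs.wordProd ω * r * (cs.wordProd ω)⁻¹ = cs.simple i) ↔
        ((cs.wordProd ω)⁻¹ * cs.simple i * cs.wordProd ω = r) := by
      rw [mul_inv_eq_iff_eq_mul, mul_assoc, inv_mul_eq_iff_eq_mul, eq_comm]
    refine Prod.ext ?_ ?_
    · simp [signedConj, mul_assoc]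
    · simp only [signedConj, h, rightInvSeq, List.count_cons, beq_iff_eq, Nat.cast_add,
        Nat.cast_ite, Nat.cast_one, Nat.cast_zero, add_assoc]

/-- The parity of the number of times `r` occurs in the right inversion sequence of a word
for `w`. -/
noncomputable def invParity (w r : W) : ZMod 2 := (cs.signedConjHom w (r, 0)).2

theorem invParity_wordProd (ω : List B) (r : W) :
    cs.invParity (cs.wordProd ω) r = ((cs.rightInvSeq ω).count r : ZMod 2) := by
  simp [invParity, signedConjHom_wordProd]

theorem signedConjHom_apply (w r : W) (ε : ZMod 2) :
    cs.signedConjHom w (r, ε) = (w * r * w⁻¹, ε + cs.invParity w r) := by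
  obtain ⟨ω, rfl⟩ := cs.wordProd_surjective w
  rw [signedConjHom_wordProd, invParity_wordProd]

theorem invParity_mul (v w r : W) :
    cs.invParity (v * w) r = cs.invParity w r + cs.invParity v (w * r * w⁻¹) := by
  have h : cs.signedConjHom (v * w) (r, 0) = cs.signedConjHom v (cs.signedConjHom w (r, 0)) := by
    rw [map_mul]; rfl
  simpa [signedConjHom_apply] using congrArg Prod.snd h

@[simp]
theorem invParity_one (r : W) : cs.invParity 1 r = 0 := by
  simpa using cs.invParity_wordProd [] r

theorem invParity_simple (i : B) (r : W) :
    cs.invParity (cs.simple i) r = if r = cs.simple i then 1 else 0 := by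
  have h := cs.invParity_wordProd [i] r
  rw [wordProd_singleton, rightInvSeq_singleton] at h
  rw [h, List.count_singleton]
  by_cases hr : r = cs.simple i
  · simp [hr]
  · simp [hr, Ne.symm hr]

theorem IsReflection.invParity_self {cs : CoxeterSystem M W} {r : W} (hr : cs.IsReflection r) :
    cs.invParity r r = 1 := by
  obtain ⟨u, i, rfl⟩ := hr
  have h := cs.invParity_mul u u⁻¹ (u * cs.simple i * u⁻¹)
  have e : u⁻¹ * (u * cs.simple i * u⁻¹) * u⁻¹⁻¹ = cs.simple i := by group
  rw [mul_inv_cancel, invParity_one, e] at h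
  rw [invParity_mul, e, invParity_mul, invParity_simple]
  simp only [cs.inv_simple, cs.simple_mul_simple_self, one_mul, if_true]
  linear_combination -h

theorem length_mul_lt_of_invParity_eq_one {w r : W} (h : cs.invParity w r = 1) :
    cs.length (w * r) < cs.length w := by
  obtain ⟨ω, hω, rfl⟩ := cs.exists_isReduced w
  rw [invParity_wordProd] at h
  refine (cs.isRightInversion_of_mem_rightInvSeq hω (List.count_pos_iff.1 ?_)).2
  rw [Nat.pos_iff_ne_zero]
  intro h0
  simp [h0] at h

theorem zmod_two_eq_zero_or_one (x : ZMod 2) : x = 0 ∨ x = 1 := by revert x; decide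

theorem IsReflection.length_lt_of_invParity_eq_zero {cs : CoxeterSystem M W} {w r : W}
    (hr : cs.IsReflection r) (h : cs.invParity w r = 0) :
    cs.length w < cs.length (w * r) := by
  have h1 : cs.invParity (w * r) r = 1 := by
    rw [invParity_mul, hr.invParity_self, mul_inv_cancel_right, h, add_zero]
  simpa [mul_assoc, hr.mul_self] using cs.length_mul_lt_of_invParity_eq_one h1

theorem finite_invParity_eq_one (w : W) : {r | cs.invParity w r = 1}.Finite := by
  obtain ⟨ω, rfl⟩ := cs.wordProd_surjective w
  refine (List.finite_toSet (cs.rightInvSeq ω)).subset fun r hr => ?_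
  rw [Set.mem_ofPred_eq, invParity_wordProd] at hr
  refine List.count_pos_iff.1 (Nat.pos_iff_ne_zero.2 fun h0 => ?_)
  simp [h0] at hr

theorem IsReflection.length_lt_of_same_side {cs : CoxeterSystem M W} {r v w : W}
    (hr : cs.IsReflection r) (h : cs.invParity w⁻¹ r = cs.invParity v⁻¹ r) :
    cs.length (w⁻¹ * v) < cs.length (w⁻¹ * r * v) := by
  have hc := cs.invParity_mul (w⁻¹ * v) v⁻¹ r
  rw [mul_inv_cancel_right, h, left_eq_add] at hc
  have hr' : cs.IsReflection (v⁻¹ * r * v⁻¹⁻¹) := hr.conj v⁻¹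
  simpa [mul_assoc] using hr'.length_lt_of_invParity_eq_zero hc

theorem length_lt_of_opposite_side {r v w : W}
    (h : cs.invParity w⁻¹ r ≠ cs.invParity v⁻¹ r) :
    cs.length (w⁻¹ * r * v) < cs.length (w⁻¹ * v) := by
  have hc := cs.invParity_mul (w⁻¹ * v) v⁻¹ r
  rw [mul_inv_cancel_right] at hc
  have h1 : cs.invParity (w⁻¹ * v) (v⁻¹ * r * v⁻¹⁻¹) = 1 := by
    refine (zmod_two_eq_zero_or_one _).resolve_left fun h0 => h ?_
    rw [hc, h0, add_zero]
  simpa [mul_assoc] using cs.length_mul_lt_of_invParity_eq_one h1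

/-- The powers of an element of infinite order inverted by the reflection `r` eventually stay on
one side of the wall of `r`. -/
theorem eventually_invParity_pow {r p : W} (hp : ¬ IsOfFinOrder p)
    (hrp : r * p * r⁻¹ = p⁻¹) :
    ∃ ε, ∃ N, ∀ n, N ≤ n → cs.invParity (p ^ n)⁻¹ r = ε := by
  have hconj : ∀ n : ℕ, (p ^ n)⁻¹ * r * p ^ n = r * p ^ (2 * n) := by
    intro n
    have h : (r * p * r⁻¹) ^ n = r * p ^ n * r⁻¹ := conj_pow
    rw [← inv_pow, ← hrp, h, inv_mul_cancel_right, mul_assoc, ← pow_add, two_mul]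
  have hinj : Function.Injective fun n : ℕ => (p ^ n)⁻¹ * r * p ^ n := by
    intro m n h
    simp only [hconj, mul_right_inj] at h
    have := injective_pow_iff_not_isOfFinOrder.2 hp h
    omega
  have hfin := (cs.finite_invParity_eq_one p⁻¹).preimage hinj.injOn
  obtain ⟨N, hN⟩ := hfin.bddAbove
  refine ⟨_, N + 1, fun n hn => Nat.le_induction rfl (fun n hn ih => ?_) n hn⟩
  rw [← ih, pow_succ, mul_inv_rev, invParity_mul, inv_inv]
  have h0 : cs.invParity p⁻¹ ((p ^ n)⁻¹ * r * p ^ n) = 0 := by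
    refine (zmod_two_eq_zero_or_one _).resolve_right fun h1 => ?_
    have := hN (show n ∈ _ from h1)
    omega
  rw [h0, add_zero]

/-- If the product of two reflections has infinite order, then one of the four quadrants cut out
by their walls is empty. -/
theorem IsReflection.exists_empty_quadrant {cs : CoxeterSystem M W} {r t : W}
    (hr : cs.IsReflection r) (ht : cs.IsReflection t) (h : ¬ IsOfFinOrder (r * t)) :
    ∃ ε δ : ZMod 2, ∀ w, ¬ (cs.invParity w⁻¹ r = ε ∧ cs.invParity w⁻¹ t = δ) := by
  obtain ⟨ε, N₁, h₁⟩ := cs.eventually_invParity_pow (r := r) h (by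
    rw [mul_inv_rev, hr.inv, ht.inv, ← mul_assoc, hr.mul_self, one_mul])
  obtain ⟨δ, N₂, h₂⟩ := cs.eventually_invParity_pow (r := t) h (by
    rw [mul_inv_rev, hr.inv, ht.inv, mul_assoc, mul_assoc, ht.mul_self, mul_one])
  refine ⟨ε, δ + 1, fun w ⟨hwr, hwt⟩ => ?_⟩
  have key : ∀ n, max N₁ N₂ ≤ n →
      cs.length (w⁻¹ * t * (r * t) ^ (n + 1)) < cs.length (w⁻¹ * t * (r * t) ^ n) := by
    intro n hn
    have a₁ := hr.length_lt_of_same_side (w := w) (v := (r * t) ^ (n + 1))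
      (hwr.trans (h₁ _ (by omega)).symm)
    have a₂ := cs.length_lt_of_opposite_side (w := w) (v := (r * t) ^ (n + 1)) (r := t) (by
      rw [hwt, h₂ _ (by omega)]
      simp)
    have e : w⁻¹ * r * (r * t) ^ (n + 1) = w⁻¹ * t * (r * t) ^ n := by
      rw [pow_succ', ← mul_assoc, mul_assoc w⁻¹, ← mul_assoc r, hr.mul_self, one_mul]
    rw [e] at a₁
    exact a₂.trans a₁
  have bound : ∀ k, cs.length (w⁻¹ * t * (r * t) ^ (max N₁ N₂ + k)) + k ≤
      cs.length (w⁻¹ * t * (r * t) ^ max N₁ N₂) := by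
    intro k
    induction k with
    | zero => simp
    | succ k ih =>
      have := key (max N₁ N₂ + k) (by omega)
      rw [add_assoc] at this
      omega
  have := bound (cs.length (w⁻¹ * t * (r * t) ^ max N₁ N₂) + 1)
  omega

theorem mem_Hp_iff (i : B) (g : W) : g ∈ Hp cs i ↔ cs.invParity g⁻¹ (cs.simple i) = 0 := by
  have e : cs.length (g⁻¹ * cs.simple i) = cs.length (cs.simple i * g) := by
    rw [← cs.length_inv, mul_inv_rev, inv_inv, cs.inv_simple]
  rw [Hp, Set.mem_ofPred_eq, ← e, ← cs.length_inv g]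
  refine ⟨fun h => (zmod_two_eq_zero_or_one _).resolve_right fun h1 => ?_,
    (cs.isReflection_simple i).length_lt_of_invParity_eq_zero⟩
  exact absurd (cs.length_mul_lt_of_invParity_eq_one h1) h.not_gt

theorem mWs_eq_mWs_iff (i : B) (g h : W) :
    mWs cs i g = mWs cs i h ↔
      cs.invParity g⁻¹ (cs.simple i) = cs.invParity h⁻¹ (cs.simple i) := by
  simp only [mWs, mem_Hp_iff]
  rcases zmod_two_eq_zero_or_one (cs.invParity g⁻¹ (cs.simple i)) with h1 | h1 <;>
  rcases zmod_two_eq_zero_or_one (cs.invParity h⁻¹ (cs.simple i)) with h2 | h2 <;>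
  simp [h1, h2]

theorem mem_StabHp_of_commute {i : B} {g : W} (hg : g * cs.simple i * g⁻¹ = cs.simple i)
    (h : cs.invParity g⁻¹ (cs.simple i) = 0) : g ∈ StabHp cs i := by
  have hg' : g⁻¹ * cs.simple i * g = cs.simple i := by
    conv_lhs => rw [← hg]
    group
  change g • Hp cs i = Hp cs i
  ext x
  rw [Set.mem_smul_set_iff_inv_smul_mem, smul_eq_mul, mem_Hp_iff, mem_Hp_iff]
  have := cs.invParity_mul (x⁻¹ * g) g⁻¹ (cs.simple i)
  rw [mul_inv_cancel_right, h, inv_inv, hg', zero_add] at this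
  rw [this, mul_inv_rev, inv_inv]

end CoxeterSystem

/-- If `W₀` is a torsion-free subgroup of a finitely generated Coxeter group `W` with
`s W₀ s = W₀`, then `m_W^s` restricted to `W₀` satisfies the Cotlar identity relative to
`W₀ ∩ Stab_{H_s^+}`. -/
theorem cotlar_on_torsionFree_subgroup [Finite B] (cs : CoxeterSystem M W) (i : B)
    (W₀ : Subgroup W)
    (htf : ∀ g ∈ W₀, g ≠ 1 → ¬ IsOfFinOrder g)
    (hconj : (fun w => cs.simple i * w * cs.simple i) '' (W₀ : Set W) = (W₀ : Set W)) :
    ∀ g ∈ W₀, g ∉ StabHp cs i → ∀ h ∈ W₀,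
      (mWs cs i g - mWs cs i h) * (mWs cs i (g⁻¹ * h) - mWs cs i g⁻¹) = 0 := by
  intro g hg hgs h hh
  by_contra hne
  rw [mul_eq_zero, not_or, sub_eq_zero, sub_eq_zero, cs.mWs_eq_mWs_iff, cs.mWs_eq_mWs_iff,
    mul_inv_rev, inv_inv] at hne
  obtain ⟨h₁, h₂⟩ := hne
  set s := cs.simple i with hs
  have hside : ∀ x, cs.invParity (x⁻¹ * g) s =
      cs.invParity g s + cs.invParity x⁻¹ (g * s * g⁻¹) := fun x => cs.invParity_mul x⁻¹ g s
  have hht : cs.invParity h⁻¹ (g * s * g⁻¹) = 1 := by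
    refine (CoxeterSystem.zmod_two_eq_zero_or_one _).resolve_left fun h0 => h₂ ?_
    rw [hside, h0, add_zero]
  by_cases hts : g * s * g⁻¹ = s
  · rw [hts] at hht
    rw [hht] at h₁
    exact hgs (cs.mem_StabHp_of_commute hts ((CoxeterSystem.zmod_two_eq_zero_or_one _).resolve_right h₁))
  have hss : s * s = 1 := cs.simple_mul_simple_self i
  have hmem : s * (g * s * g⁻¹) ∈ W₀ := by
    have h1 : s * g * s ∈ W₀ := by
      have : s * g * s ∈ (W₀ : Set W) := hconj ▸ ⟨g, hg, rfl⟩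
      exact this
    simpa [mul_assoc] using W₀.mul_mem h1 (W₀.inv_mem hg)
  have hne1 : s * (g * s * g⁻¹) ≠ 1 := fun h1 => hts (by
    simpa [hs] using eq_inv_of_mul_eq_one_right h1)
  obtain ⟨ε, δ, hq⟩ := (cs.isReflection_simple i).exists_empty_quadrant
    ((cs.isReflection_simple i).conj g) (htf _ hmem hne1)
  rw [← hs] at hq
  have hself : cs.invParity s s = 1 := (cs.isReflection_simple i).invParity_self
  have hsinv : s⁻¹ = s := cs.inv_simple i
  have q_one := hq 1
  have q_s := hq s
  have q_g := hq g
  have q_gs := hq (g * s)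
  have q_h := hq h
  have e_g : cs.invParity g⁻¹ (g * s * g⁻¹) = cs.invParity g s := by
    have := hside g
    rw [inv_mul_cancel, cs.invParity_one] at this
    exact (CharTwo.add_eq_zero.1 this.symm).symm
  have e_gs : cs.invParity (g * s)⁻¹ (g * s * g⁻¹) = cs.invParity g s + 1 := by
    rw [mul_inv_rev, cs.invParity_mul, e_g, hsinv]
    simp [mul_assoc, hself]
  have e_gs' : cs.invParity (g * s)⁻¹ s = cs.invParity g⁻¹ s := by
    rw [mul_inv_rev, cs.invParity_mul, hsinv, hs, cs.invParity_simple, if_neg, add_zero]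
    intro h1
    apply hts
    rw [← hs, inv_inv] at h1
    conv_lhs => rw [← h1]
    group
  have e_s : cs.invParity s (g * s * g⁻¹) = 0 := by
    rw [hs, cs.invParity_simple, if_neg]
    exact hts
  rw [inv_one, cs.invParity_one, cs.invParity_one] at q_one
  rw [hsinv, hself, e_s] at q_s
  rw [e_g] at q_g
  rw [e_gs, e_gs'] at q_gs
  rw [hht] at q_h
  generalize cs.invParity g⁻¹ s = x at *
  generalize cs.invParity g s = y at *
  generalize cs.invParity h⁻¹ s = z at *
  clear * - q_one q_s q_g q_gs q_h h₁
  have h11 : (1 : ZMod 2) + 1 = 0 := rfl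
  rcases CoxeterSystem.zmod_two_eq_zero_or_one ε with rfl | rfl <;>
  rcases CoxeterSystem.zmod_two_eq_zero_or_one δ with rfl | rfl <;>
  rcases CoxeterSystem.zmod_two_eq_zero_or_one x with rfl | rfl <;>
  rcases CoxeterSystem.zmod_two_eq_zero_or_one y with rfl | rfl <;>
  rcases CoxeterSystem.zmod_two_eq_zero_or_one z with rfl | rfl <;>
  simp_all
end
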